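/- Let s ∈ ℤ_2 satisfy s² = −n, let e = (n+1)/(2n) + ((1+s)/(2n))·f_Q(X) + ((1−s)/(2n))·f_N(X) ∈ R, and let C = {c ∈ ℤ_2^n : the image of Σ_{j=0}^{n−1} c_j X^j in R lies in the ideal of R generated by e}. Let t ∈ ℤ_2 satisfy n·t² = −1 (such t exists), and let C̃ = {(c₀, …, c_{n−1}, t·Σ_{j=0}^{n−1} c_j) : c ∈ C} ⊆ ℤ_2^{n+1}. Then every nonzero element of C̃ has Hamming weight at least (n+3)/2, and some nonzero element of C̃ has Hamming weight exactly (n+3)/2. -/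

import Mathlib

open Polynomial
open scoped Classical

/-- `f_Q(X) = ∑_{k ∈ Q} X^k`, where `Q` is the set of `k` with `1 ≤ k ≤ n-1` that are
quadratic residues modulo `n`, as a polynomial over the 2-adic integers. -/
noncomputable def fQpoly (n : ℕ) : Polynomial ℤ_[2] :=
  ∑ k ∈ (Finset.Ico 1 n).filter (fun k : ℕ => IsSquare ((k : ZMod n))), X ^ k

/-- `f_N(X) = ∑_{k ∈ N} X^k`, where `N` is the set of `k` with `1 ≤ k ≤ n-1` that are
quadratic nonresidues modulo `n`, as a polynomial over the 2-adic integers. -/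
noncomputable def fNpoly (n : ℕ) : Polynomial ℤ_[2] :=
  ∑ k ∈ (Finset.Ico 1 n).filter (fun k : ℕ => ¬ IsSquare ((k : ZMod n))), X ^ k

/-- The idempotent `α + β f_Q(X) + γ f_N(X)` in `R = ℤ_2[X]/(X^n - 1)`. -/
noncomputable def qrIdempotent (n : ℕ) (α β γ : ℤ_[2]) :
    Polynomial ℤ_[2] ⧸ Ideal.span {(X : Polynomial ℤ_[2]) ^ n - 1} :=
  Ideal.Quotient.mk _ (C α + C β * fQpoly n + C γ * fNpoly n)

/-- The quadratic residue code `C ⊆ ℤ_2^n`: vectors whose associated polynomial lies in the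
ideal of `R = ℤ_2[X]/(X^n - 1)` generated by the idempotent `α + β f_Q + γ f_N`. -/
def qrCode (n : ℕ) (α β γ : ℤ_[2]) : Set (Fin n → ℤ_[2]) :=
  {c | Ideal.Quotient.mk (Ideal.span {(X : Polynomial ℤ_[2]) ^ n - 1})
      (∑ j : Fin n, C (c j) * X ^ (j : ℕ)) ∈ Ideal.span {qrIdempotent n α β γ}}

/-- The extended code `C̃ ⊆ ℤ_2^{n+1}`, obtained by appending `t·Σ c_j` to each codeword. -/
def qrCodeExt (n : ℕ) (α β γ t : ℤ_[2]) : Set (Fin (n + 1) → ℤ_[2]) :=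
  {v | ∃ c ∈ qrCode n α β γ, v = Fin.snoc c (t * ∑ j, c j)}

/-- The Hamming weight of a vector: the number of nonzero coordinates. -/
noncomputable def hwt {m : ℕ} (v : Fin m → ℤ_[2]) : ℕ :=
  (Finset.univ.filter (fun i => v i ≠ 0)).card


lemma aux_sparse {F : Type*} [Field F] (p : ℕ) [CharP F p] :
    ∀ (k : ℕ) (f : F[X]), f ≠ 0 → (∀ i ∈ f.support, i < p) → (X - 1) ^ k ∣ f →
      k < f.support.card := by
  intro k
  induction k with
  | zero =>
    intro f hf _ _
    exact Finset.card_pos.mpr (Polynomial.support_nonempty.mpr hf)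
  | succ k ih =>
    intro f hf hp hd
    obtain ⟨r, hr⟩ := Polynomial.support_nonempty.mpr hf
    set g : F[X] := X * derivative f - C (r : F) * f with hg
    have hc : ∀ j, g.coeff j = ((j : F) - r) * f.coeff j := by
      intro j
      rw [hg, coeff_sub, coeff_C_mul]
      cases j with
      | zero => simp
      | succ j => rw [coeff_X_mul, coeff_derivative]; push_cast; ring
    have hs : g.support = f.support.erase r := by
      ext j
      rw [Finset.mem_erase, mem_support_iff, hc]
      constructor
      · intro h
        refine ⟨?_, mem_support_iff.mpr (right_ne_zero_of_mul h)⟩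
        rintro rfl
        simp at h
      · rintro ⟨h1, h2⟩
        refine mul_ne_zero ?_ (mem_support_iff.mp h2)
        intro h
        have h3 : (j : F) = r := sub_eq_zero.mp h
        rw [CharP.natCast_eq_natCast F p] at h3
        exact h1 (Nat.ModEq.eq_of_lt_of_lt h3 (hp j h2) (hp r hr))
    have hgd : (X - 1) ^ k ∣ g := by
      obtain ⟨q, rfl⟩ := hd
      refine dvd_sub (Dvd.dvd.mul_left ?_ _) (Dvd.dvd.mul_left ?_ _)
      · rw [derivative_mul, derivative_pow]
        refine dvd_add ?_ ?_
        · refine Dvd.dvd.mul_right (Dvd.dvd.mul_right (Dvd.dvd.mul_left ?_ _) _) _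
          simp
        · exact Dvd.dvd.mul_right (pow_dvd_pow _ (Nat.le_succ k)) _
      · exact Dvd.dvd.mul_right (pow_dvd_pow _ (Nat.le_succ k)) _
    have hcard : g.support.card + 1 = f.support.card := by
      rw [hs]; exact Finset.card_erase_add_one hr
    by_cases h0 : g = 0
    · exfalso
      have h1 : f.support.card ≤ 1 := by rw [← hcard, h0]; simp
      obtain ⟨i, a, rfl⟩ := (Polynomial.card_support_le_one_iff_monomial).mp h1
      have h2 : (X - 1 : F[X]) ∣ monomial i a := (dvd_pow_self _ (Nat.succ_ne_zero k)).trans hd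
      obtain ⟨q, hq⟩ := h2
      have := congrArg (eval 1) hq
      simp at this
      simp [this] at hf
    · have := ih g h0 (fun i hi => hp i (by rw [hs] at hi; exact Finset.mem_of_mem_erase hi)) hgd
      omega

lemma aux_cheb {K : Type*} [Field K] [CharZero K] (p : ℕ) (hp : p.Prime) (S : Finset K)
    (hS : ∀ x ∈ S, x ^ p = 1) (f : K[X]) (hf : f ≠ 0) (hfp : ∀ i ∈ f.support, i < p)
    (hz : ∀ x ∈ S, f.eval x = 0) : S.card < f.support.card := by
  have hV : ∃ V : ValuationSubring K, (p : K) ∈ V.nonunits := by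
    let A : Subring K := (Int.castRingHom K).range
    have hpA : (p : K) ∈ A := ⟨p, by simp⟩
    obtain ⟨V, _, hV2⟩ := Ideal.image_subset_nonunits_valuationSubring (A := A)
      (Ideal.span {⟨p, hpA⟩}) (by
        intro h
        rw [Ideal.span_singleton_eq_top] at h
        obtain ⟨⟨b, ⟨z, rfl⟩⟩, hb⟩ := isUnit_iff_exists_inv.mp h
        have h1 := congrArg Subtype.val hb
        simp at h1
        have h2 : (p : ℤ) * z = 1 := by exact_mod_cast h1
        have h3 : (p : ℤ) ∣ 1 := ⟨z, h2.symm⟩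
        have := hp.one_lt
        have := Int.le_of_dvd one_pos h3
        omega)
    exact ⟨V, hV2 ⟨⟨p, hpA⟩, Ideal.subset_span rfl, rfl⟩⟩
  obtain ⟨V, hV⟩ := hV
  have hSV : ∀ x ∈ S, x ∈ V := by
    intro x hx
    rcases V.mem_or_inv_mem x with h | h
    · exact h
    · have : x = (x⁻¹) ^ (p - 1) := by
        have h1 := hS x hx
        have hx0 : x ≠ 0 := by rintro rfl; simp [hp.ne_zero] at h1
        rw [inv_pow]
        apply eq_inv_of_mul_eq_one_left
        rw [← pow_succ', Nat.sub_add_cancel hp.one_le, h1]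
      rw [this]; exact pow_mem h _
  have hpm : (p : V) ∈ IsLocalRing.maximalIdeal V := by
    rw [← SetLike.mem_coe, ← V.image_maximalIdeal] at hV
    obtain ⟨y, hy, hy2⟩ := hV
    have : y = (p : V) := Subtype.ext (by simpa using hy2)
    rwa [← this]
  let κ := IsLocalRing.ResidueField V
  have hκ : (p : κ) = 0 := by
    have := (IsLocalRing.residue_eq_zero_iff (R := V) (p : V)).mpr hpm
    simpa using this
  have : Fact p.Prime := ⟨hp⟩
  have : CharP κ p := (CharP.charP_iff_prime_eq_zero hp).mpr hκ
  obtain ⟨i0, hi0, hmax⟩ := Finset.exists_max_image f.support (fun i => V.valuation (f.coeff i))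
    (Polynomial.support_nonempty.mpr hf)
  have ha : f.coeff i0 ≠ 0 := mem_support_iff.mp hi0
  set h : K[X] := C (f.coeff i0)⁻¹ * f with hh
  have hmem : ∀ i, h.coeff i ∈ V := by
    intro i
    rw [hh, coeff_C_mul]
    by_cases hi : i ∈ f.support
    · rw [← V.valuation_le_one_iff, map_mul, map_inv₀]
      have h1 := hmax i hi
      have h2 : V.valuation (f.coeff i0) ≠ 0 := by simpa using ha
      rw [mul_comm, ← div_eq_mul_inv]
      exact div_le_one_of_le₀ h1 zero_le
    · rw [notMem_support_iff.mp hi, mul_zero]; exact V.zero_mem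
  have hlift : h ∈ lifts (algebraMap V K) := by
    rw [lifts_iff_coeff_lifts]
    intro i
    exact ⟨⟨_, hmem i⟩, rfl⟩
  obtain ⟨h', hh'⟩ := (mem_lifts _).mp hlift
  have hinj : Function.Injective (algebraMap V K) := IsFractionRing.injective V K
  have hcoeff : ∀ i, algebraMap V K (h'.coeff i) = (f.coeff i0)⁻¹ * f.coeff i := by
    intro i; rw [← coeff_map, hh', hh, coeff_C_mul]
  have hone : h'.coeff i0 = 1 := hinj (by rw [hcoeff, map_one, inv_mul_cancel₀ ha])
  have hne : h' ≠ 0 := by rintro rfl; simp at hone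
  let T : Finset V := S.attach.image (fun x => ⟨x.1, hSV x.1 x.2⟩)
  have hT : T.card = S.card := by
    rw [Finset.card_image_of_injective, Finset.card_attach]
    intro x y hxy
    exact Subtype.ext (congrArg (fun z : V => (z : K)) hxy)
  have hTS : ∀ y ∈ T, (y : K) ∈ S := by
    intro y hy
    obtain ⟨x, _, rfl⟩ := Finset.mem_image.mp hy
    exact x.2
  have hdvd : (T.val.map (fun a => X - C a)).prod ∣ h' := by
    rw [Multiset.prod_X_sub_C_dvd_iff_le_roots hne, Multiset.le_iff_subset T.nodup]
    intro y hy
    rw [mem_roots hne, IsRoot.def]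
    apply hinj
    rw [map_zero, ← eval_map_apply, hh', hh, eval_mul]
    have : eval (algebraMap V K y) f = 0 := hz _ (hTS y hy)
    rw [this, mul_zero]
  have hres : ∀ y ∈ T, IsLocalRing.residue V y = 1 := by
    intro y hy
    have h1 : y ^ p = 1 := Subtype.ext (by simpa using hS _ (hTS y hy))
    have h2 : (IsLocalRing.residue V y) ^ p = 1 := by rw [← map_pow, h1, map_one]
    have h3 : (IsLocalRing.residue V y - 1 : κ) ^ p = 0 := by
      rw [sub_pow_char, h2]; simp
    exact sub_eq_zero.mp (pow_eq_zero_iff hp.ne_zero |>.mp h3)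
  have hd2 : (X - 1 : κ[X]) ^ S.card ∣ h'.map (IsLocalRing.residue V) := by
    have := map_dvd (mapRingHom (IsLocalRing.residue V)) hdvd
    rw [← hT]
    convert this using 1
    · rw [map_multiset_prod, Multiset.map_map]
      change _ = ∏ y ∈ T, _
      rw [Finset.prod_congr rfl (g := fun _ => (X - 1 : κ[X])), Finset.prod_const]
      intro y hy
      simp [hres y hy]
    · rfl
  have hsub : (h'.map (IsLocalRing.residue V)).support ⊆ f.support := by
    intro i hi
    rw [mem_support_iff, coeff_map] at hi
    rw [mem_support_iff]
    intro h0
    have h1 := hcoeff i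
    rw [h0, mul_zero] at h1
    have : h'.coeff i = 0 := hinj (by rw [h1, map_zero])
    rw [this, map_zero] at hi
    exact hi rfl
  have hne2 : h'.map (IsLocalRing.residue V) ≠ 0 := by
    intro h0
    have := congrArg (fun q => coeff q i0) h0
    simp [coeff_map, hone] at this
  exact (aux_sparse (F := κ) p _ _ hne2 (fun i hi => hfp i (hsub hi)) hd2).trans_le
    (Finset.card_le_card hsub)

noncomputable def auxQ {L : Type*} [Field L] (n : ℕ) (x : L) : L :=
  ∑ k ∈ (Finset.Ico 1 n).filter (fun k : ℕ => IsSquare ((k : ZMod n))), x ^ k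

noncomputable def auxN {L : Type*} [Field L] (n : ℕ) (x : L) : L :=
  ∑ k ∈ (Finset.Ico 1 n).filter (fun k : ℕ => ¬ IsSquare ((k : ZMod n))), x ^ k

noncomputable def auxD {L : Type*} [Field L] (n : ℕ) (x : L) : L := auxQ n x - auxN n x

lemma auxD_eq {L : Type*} [Field L] (n : ℕ) [Fact n.Prime] (x : L) (hx : x ^ n = 1) :
    auxD n x = gaussSum ((quadraticChar (ZMod n)).ringHomComp (Int.castRingHom L))
      (AddChar.zmodChar n hx) := by
  have hn : n.Prime := Fact.out
  rw [auxD, auxQ, auxN, gaussSum, Finset.sum_filter, Finset.sum_filter, ← Finset.sum_sub_distrib]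
  rw [← Finset.add_sum_erase Finset.univ _ (Finset.mem_univ (0 : ZMod n))]
  simp only [zero_mul, zero_add, MulChar.map_zero]
  refine Finset.sum_bij' (fun k _ => (k : ZMod n)) (fun a _ => a.val) ?_ ?_ ?_ ?_ ?_
  · intro k hk
    rw [Finset.mem_Ico] at hk
    simp only [Finset.mem_erase, Finset.mem_univ, and_true]
    intro h
    rw [ZMod.natCast_eq_zero_iff] at h
    have := Nat.le_of_dvd (by omega) h
    omega
  · intro a ha
    simp only [Finset.mem_erase, Finset.mem_univ, and_true] at ha
    rw [Finset.mem_Ico]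
    exact ⟨Nat.one_le_iff_ne_zero.mpr (by simpa using ha), ZMod.val_lt a⟩
  · intro k hk
    rw [Finset.mem_Ico] at hk
    exact ZMod.val_cast_of_lt hk.2
  · intro a _
    simp
  · intro k hk
    rw [Finset.mem_Ico] at hk
    have h0 : (k : ZMod n) ≠ 0 := by
      intro h
      rw [ZMod.natCast_eq_zero_iff] at h
      have := Nat.le_of_dvd (by omega) h
      omega
    rw [AddChar.zmodChar_apply', MulChar.ringHomComp_apply, quadraticChar_apply, quadraticCharFun,
      if_neg h0]
    by_cases h : IsSquare (k : ZMod n) <;> simp [h]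

lemma aux_chi {L : Type*} [Field L] (n : ℕ) [Fact n.Prime] (h8 : n % 8 = 7) :
    ((quadraticChar (ZMod n)).ringHomComp (Int.castRingHom L)) (-1) = -1 := by
  have : quadraticChar (ZMod n) (-1) = -1 := by
    rw [quadraticChar_neg_one_iff_not_isSquare, ZMod.exists_sq_eq_neg_one_iff]
    omega
  rw [MulChar.ringHomComp_apply, this]; simp

lemma auxD_sq {L : Type*} [Field L] [CharZero L] (n : ℕ) [Fact n.Prime] (h8 : n % 8 = 7) (x : L)
    (hx : x ^ n = 1) (hx1 : x ≠ 1) : auxD n x ^ 2 = -n := by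
  have hn : n.Prime := Fact.out
  have hprim : IsPrimitiveRoot x n := by
    have := orderOf_eq_prime hx hx1
    exact this ▸ IsPrimitiveRoot.orderOf x
  have hring : ringChar (ZMod n) ≠ 2 := by
    rw [ZMod.ringChar_zmod_n]; omega
  rw [auxD_eq n x hx, gaussSum_sq, aux_chi n h8, ZMod.card]
  · ring
  · intro h
    have h1 := aux_chi (L := L) n h8
    rw [h, MulChar.one_apply (by simp)] at h1
    norm_num at h1
  · exact (quadraticChar_isQuadratic _).comp _
  · exact AddChar.zmodChar_primitive_of_primitive_root n hprim

lemma auxD_inv {L : Type*} [Field L] (n : ℕ) [Fact n.Prime] (h8 : n % 8 = 7) (x : L)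
    (hx : x ^ n = 1) : auxD n x⁻¹ = - auxD n x := by
  have hx' : (x⁻¹) ^ n = 1 := by rw [inv_pow, hx, inv_one]
  rw [auxD_eq n x hx, auxD_eq n _ hx']
  have h1 := gaussSum_mulShift ((quadraticChar (ZMod n)).ringHomComp (Int.castRingHom L))
      (AddChar.zmodChar n hx) (-1)
  have h2 : AddChar.mulShift (AddChar.zmodChar n hx) ((-1 : (ZMod n)ˣ) : ZMod n)
      = AddChar.zmodChar n hx' := by
    ext a
    rw [AddChar.mulShift_apply, Units.val_neg, Units.val_one, neg_one_mul, AddChar.map_neg_eq_inv,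
      AddChar.zmodChar_apply, AddChar.zmodChar_apply, inv_pow]
  rw [h2, Units.val_neg, Units.val_one, aux_chi n h8] at h1
  rw [← h1]; ring

lemma aux_sum {L : Type*} [Field L] (n : ℕ) (hn : n.Prime) (x : L)
    (hx : x ^ n = 1) (hx1 : x ≠ 1) :
    auxQ n x + auxN n x = -1 := by
  rw [auxQ, auxN]
  rw [Finset.sum_filter_add_sum_filter_not]
  have h1 : ∑ k ∈ Finset.range n, x ^ k = 0 := by
    rw [geom_sum_eq hx1, hx]; simp
  rw [Finset.range_eq_Ico, Finset.sum_eq_sum_Ico_succ_bot hn.pos] at h1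
  simp at h1
  exact eq_neg_of_add_eq_zero_right h1

lemma aux_Z {L : Type*} [Field L] [CharZero L] [IsAlgClosed L] (ι : ℤ_[2] →+* L)
    (n : ℕ) (hn : n.Prime) (hn8 : n % 8 = 7)
    (s : ℤ_[2]) (hs : s ^ 2 = -(n : ℤ_[2]))
    (α β γ : ℤ_[2])
    (hα : 2 * (n : ℤ_[2]) * α = n + 1)
    (hβ : 2 * (n : ℤ_[2]) * β = 1 + s)
    (hγ : 2 * (n : ℤ_[2]) * γ = 1 - s) :
    ∃ Z : Finset L, Z.card = (n - 1) / 2 ∧ (∀ x ∈ Z, x ^ n = 1 ∧ x ≠ 1) ∧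
      ∀ x, x ^ n = 1 → (eval₂ ι x (C α + C β * fQpoly n + C γ * fNpoly n) = 0 ↔ x ∈ Z) := by
  have : Fact n.Prime := ⟨hn⟩
  have hn0 : (n : L) ≠ 0 := by exact_mod_cast hn.ne_zero
  have hs' : ι s ^ 2 = -n := by rw [← map_pow, hs]; simp
  have h2' : ι 2 = 2 := map_ofNat ι 2
  have hα' : 2 * (n : L) * ι α = n + 1 := by
    have h := congrArg ι hα
    simpa [h2'] using h
  have hβ' : 2 * (n : L) * ι β = 1 + ι s := by
    have h := congrArg ι hβ
    simpa [h2'] using h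
  have hγ' : 2 * (n : L) * ι γ = 1 - ι s := by
    have h := congrArg ι hγ
    simpa [h2'] using h
  have hs0 : ι s ≠ 0 := by
    intro h; rw [h] at hs'; apply hn0; simpa using hs'.symm
  have hn2 : 2 * (n : L) ≠ 0 := mul_ne_zero two_ne_zero hn0
  let U : Finset L := (nthRootsFinset n (1 : L)).erase 1
  have hU : ∀ x, x ∈ U ↔ x ^ n = 1 ∧ x ≠ 1 := by
    intro x
    rw [Finset.mem_erase, mem_nthRootsFinset hn.pos, and_comm]
  have hUc : U.card = n - 1 := by
    have : NeZero (n : L) := ⟨hn0⟩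
    obtain ⟨ζ, hζ⟩ := HasEnoughRootsOfUnity.exists_primitiveRoot L n
    rw [Finset.card_erase_of_mem (by rw [mem_nthRootsFinset hn.pos]; simp), hζ.card_nthRootsFinset]
  have hD : ∀ x ∈ U, auxD n x = ι s ∨ auxD n x = - ι s := by
    intro x hx
    obtain ⟨h1, h2⟩ := (hU x).mp hx
    apply sq_eq_sq_iff_eq_or_eq_neg.mp
    rw [auxD_sq n hn8 x h1 h2, hs']
  have hneg : ι s ≠ - ι s := by
    intro h
    apply hs0
    have : 2 * ι s = 0 := by linear_combination h
    simpa using this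
  refine ⟨U.filter (fun x => auxD n x = ι s), ?_, ?_, ?_⟩
  · have h1 : (U.filter (fun x => auxD n x = ι s)).card
        = (U.filter (fun x => ¬ auxD n x = ι s)).card := by
      refine Finset.card_bij' (fun x _ => x⁻¹) (fun x _ => x⁻¹) ?_ ?_ ?_ ?_
      · intro x hx
        rw [Finset.mem_filter] at hx ⊢
        obtain ⟨h1, h2⟩ := (hU x).mp hx.1
        refine ⟨(hU _).mpr ⟨by rw [inv_pow, h1, inv_one], by simpa using h2⟩, ?_⟩
        rw [auxD_inv n hn8 x h1, hx.2]
        exact fun h => hneg h.symm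
      · intro x hx
        rw [Finset.mem_filter] at hx ⊢
        obtain ⟨h1, h2⟩ := (hU x).mp hx.1
        refine ⟨(hU _).mpr ⟨by rw [inv_pow, h1, inv_one], by simpa using h2⟩, ?_⟩
        rw [auxD_inv n hn8 x h1, (hD x hx.1).resolve_left hx.2, neg_neg]
      · intro x _; simp
      · intro x _; simp
    have h2 := Finset.card_filter_add_card_filter_not (s := U) (fun x => auxD n x = ι s)
    omega
  · intro x hx
    exact (hU x).mp (Finset.mem_filter.mp hx).1
  · intro x hx
    rw [Finset.mem_filter, hU]
    set q := auxQ n x with hq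
    set r := auxN n x with hr
    have he : eval₂ ι x (C α + C β * fQpoly n + C γ * fNpoly n) = ι α + ι β * q + ι γ * r := by
      simp [eval₂_add, eval₂_mul, fQpoly, fNpoly, eval₂_finsetSum, hq, hr, auxQ, auxN]
    have he2 : 2 * (n : L) * (ι α + ι β * q + ι γ * r) = (n + 1) + (q + r) + ι s * (q - r) := by
      linear_combination hα' + q * hβ' + r * hγ'
    have hDx : auxD n x = q - r := rfl
    rw [he]
    by_cases hx1 : x = 1
    · have hsum : q + r = n - 1 := by
        rw [hq, hr, auxQ, auxN, Finset.sum_filter_add_sum_filter_not, hx1]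
        simp [Nat.cast_sub hn.one_le]
      have hdiff : q - r = 0 := by
        have := auxD_inv n hn8 x hx
        rw [hx1, inv_one] at this
        rw [← hDx, hx1]
        have h3 : 2 * auxD n (1 : L) = 0 := by linear_combination this
        simpa using h3
      rw [hsum, hdiff] at he2
      constructor
      · intro h
        rw [h] at he2
        exfalso; apply hn2; linear_combination -he2
      · intro h; exact absurd hx1 h.1.2
    · have hsum : q + r = -1 := aux_sum n hn x hx hx1
      rw [hsum, ← hDx] at he2
      have hxU := (hU x).mpr ⟨hx, hx1⟩
      constructor
      · intro h
        refine ⟨⟨hx, hx1⟩, ?_⟩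
        rw [h] at he2
        rcases hD x hxU with h1 | h1
        · exact h1
        · exfalso
          rw [h1] at he2
          apply hn2
          linear_combination -he2 + hs'
      · rintro ⟨_, h⟩
        rw [h] at he2
        have : 2 * (n : L) * (ι α + ι β * q + ι γ * r) = 0 := by linear_combination he2 + hs'
        exact (mul_eq_zero.mp this).resolve_left hn2

lemma aux_snoc (n : ℕ) (c : Fin n → ℤ_[2]) (a : ℤ_[2]) :
    hwt (Fin.snoc c a : Fin (n + 1) → ℤ_[2]) = hwt c + if a ≠ 0 then 1 else 0 := by
  unfold hwt
  rw [Finset.card_filter, Finset.card_filter, Fin.sum_univ_castSucc]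
  simp

lemma aux_poly_coeff (n : ℕ) (c : Fin n → ℤ_[2]) (i : Fin n) :
    (∑ j : Fin n, C (c j) * X ^ (j : ℕ)).coeff (i : ℕ) = c i := by
  rw [finsetSum_coeff, Finset.sum_eq_single i]
  · simp
  · intro j _ hj
    rw [coeff_C_mul_X_pow, if_neg]
    intro h
    exact hj (Fin.ext h.symm)
  · simp

lemma aux_poly_coeff' (n : ℕ) (c : Fin n → ℤ_[2]) (i : ℕ) (hi : n ≤ i) :
    (∑ j : Fin n, C (c j) * X ^ (j : ℕ)).coeff i = 0 := by
  rw [finsetSum_coeff]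
  apply Finset.sum_eq_zero
  intro j _
  rw [coeff_C_mul_X_pow, if_neg]
  omega

lemma aux_supp (n : ℕ) (c : Fin n → ℤ_[2]) :
    (∑ j : Fin n, C (c j) * X ^ (j : ℕ)).support.card = hwt c := by
  unfold hwt
  symm
  refine Finset.card_bij (fun i _ => (i : ℕ)) ?_ ?_ ?_
  · intro i hi
    rw [mem_support_iff, aux_poly_coeff]
    exact (Finset.mem_filter.mp hi).2
  · intro i _ j _ h
    exact Fin.ext h
  · intro i hi
    rw [mem_support_iff] at hi
    have h : i < n := by
      by_contra h
      exact hi (aux_poly_coeff' n c i (by omega))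
    refine ⟨⟨i, h⟩, ?_, rfl⟩
    rw [Finset.mem_filter]
    exact ⟨Finset.mem_univ _, by rw [← aux_poly_coeff n c ⟨i, h⟩]; exact hi⟩

lemma aux_mem (n : ℕ) (α β γ : ℤ_[2]) (c : Fin n → ℤ_[2]) :
    c ∈ qrCode n α β γ ↔ ∃ a b : ℤ_[2][X], ∑ j : Fin n, C (c j) * X ^ (j : ℕ) =
      (C α + C β * fQpoly n + C γ * fNpoly n) * a + (X ^ n - 1) * b := by
  unfold qrCode qrIdempotent
  rw [Set.mem_setOf_eq, Ideal.mem_span_singleton']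
  constructor
  · rintro ⟨a, ha⟩
    obtain ⟨a, rfl⟩ := Ideal.Quotient.mk_surjective a
    rw [← map_mul, eq_comm, Ideal.Quotient.mk_eq_mk_iff_sub_mem, Ideal.mem_span_singleton'] at ha
    obtain ⟨b, hb⟩ := ha
    exact ⟨a, b, by linear_combination -hb⟩
  · rintro ⟨a, b, h⟩
    refine ⟨Ideal.Quotient.mk _ a, ?_⟩
    rw [← map_mul, eq_comm, Ideal.Quotient.mk_eq_mk_iff_sub_mem, Ideal.mem_span_singleton']
    exact ⟨b, by linear_combination -h⟩

lemma aux_lower {L : Type*} [Field L] [CharZero L] (ι : ℤ_[2] →+* L)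
    (hι : Function.Injective ι)
    (n : ℕ) (hn : n.Prime) (hn8 : n % 8 = 7) (α β γ t : ℤ_[2]) (ht : t ≠ 0)
    (Z : Finset L) (hZc : Z.card = (n - 1) / 2) (hZ1 : ∀ x ∈ Z, x ^ n = 1 ∧ x ≠ 1)
    (hZ : ∀ x, x ^ n = 1 → (eval₂ ι x (C α + C β * fQpoly n + C γ * fNpoly n) = 0 ↔ x ∈ Z)) :
    ∀ v ∈ qrCodeExt n α β γ t, v ≠ 0 → (n + 3) / 2 ≤ hwt v := by
  rintro v ⟨c, hc, rfl⟩ hv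
  obtain ⟨a, b, hab⟩ := (aux_mem n α β γ c).mp hc
  have hc0 : c ≠ 0 := by
    rintro rfl
    apply hv
    ext i
    refine Fin.lastCases ?_ (fun i => ?_) i <;> simp
  set p := ∑ j : Fin n, C (c j) * X ^ (j : ℕ) with hp
  have hsupp : (p.map ι).support = p.support := support_map_of_injective p hι
  have hp0 : p.map ι ≠ 0 := by
    rw [Polynomial.map_ne_zero_iff hι]
    intro h0
    apply hc0
    ext i
    rw [← aux_poly_coeff n c i, ← hp, h0]; simp
  have hpn : ∀ i ∈ (p.map ι).support, i < n := by
    intro i hi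
    rw [hsupp, mem_support_iff] at hi
    by_contra h
    exact hi (aux_poly_coeff' n c i (by omega))
  have hpZ : ∀ x ∈ Z, (p.map ι).eval x = 0 := by
    intro x hx
    rw [eval_map, hab, eval₂_add, eval₂_mul, eval₂_mul, (hZ x (hZ1 x hx).1).mpr hx]
    simp [(hZ1 x hx).1]
  rw [aux_snoc]
  by_cases hsum : ∑ j, c j = 0
  · have h1 : (p.map ι).eval 1 = 0 := by
      rw [eval_map, hp, eval₂_finsetSum]
      simp [← map_sum, hsum]
    have hnot : (1 : L) ∉ Z := fun h => (hZ1 1 h).2 rfl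
    have := aux_cheb n hn (insert 1 Z) (by
        intro x hx
        rcases Finset.mem_insert.mp hx with rfl | hx
        · simp
        · exact (hZ1 x hx).1) (p.map ι) hp0 hpn (by
        intro x hx
        rcases Finset.mem_insert.mp hx with rfl | hx
        · exact h1
        · exact hpZ x hx)
    rw [hsupp, hp, aux_supp, Finset.card_insert_of_notMem hnot, hZc] at this
    omega
  · have := aux_cheb n hn Z (fun x hx => (hZ1 x hx).1) (p.map ι) hp0 hpn hpZ
    rw [hsupp, hp, aux_supp, hZc] at this
    rw [if_pos (mul_ne_zero ht hsum)]
    omega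

lemma aux_word (n : ℕ) (hn : n.Prime) (P : ℤ_[2][X])
    (Z : Finset (AlgebraicClosure ℚ_[2])) (hZc : Z.card = (n - 1) / 2)
    (hZ : ∀ x, x ^ n = 1 → eval₂ ((algebraMap ℚ_[2] (AlgebraicClosure ℚ_[2])).comp
      (algebraMap ℤ_[2] ℚ_[2])) x P = 0 → x ∈ Z) :
    ∃ a b : ℤ_[2][X], P * a + (X ^ n - 1) * b ≠ 0 ∧
      (P * a + (X ^ n - 1) * b).natDegree ≤ (n - 1) / 2 := by
  set j := algebraMap ℚ_[2] (AlgebraicClosure ℚ_[2])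
  set i := algebraMap ℤ_[2] ℚ_[2] with hi
  have hiinj : Function.Injective i := IsFractionRing.injective _ _
  set M : ℚ_[2][X] := X ^ n - 1 with hM
  have hM0 : M ≠ 0 := X_pow_sub_C_ne_zero hn.pos 1
  set d := EuclideanDomain.gcd (P.map i) M with hd
  have hbez := EuclideanDomain.gcd_eq_gcd_ab (P.map i) M
  have hdM : d ∣ M := EuclideanDomain.gcd_dvd_right _ _
  have hdP : d ∣ P.map i := EuclideanDomain.gcd_dvd_left _ _
  have hd0 : d ≠ 0 := ne_zero_of_dvd_ne_zero hM0 hdM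
  have hdeg : d.natDegree ≤ (n - 1) / 2 := by
    have hsep : d.Separable := by
      refine Separable.of_dvd ?_ hdM
      exact separable_X_pow_sub_C (1 : ℚ_[2]) (by exact_mod_cast hn.ne_zero) one_ne_zero
    have hnd : (d.map j).roots.Nodup := nodup_roots hsep.map
    have hsub : (d.map j).roots.toFinset ⊆ Z := by
      intro x hx
      rw [Multiset.mem_toFinset, mem_roots', IsRoot.def] at hx
      obtain ⟨q, hq⟩ := hdM
      obtain ⟨r, hr⟩ := hdP
      apply hZ
      · have : (M.map j).eval x = 0 := by rw [hq, Polynomial.map_mul, eval_mul, hx.2, zero_mul]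
        rw [hM] at this
        simpa [sub_eq_zero] using this
      · rw [← eval_map, ← Polynomial.map_map, hr, Polynomial.map_mul, eval_mul, hx.2, zero_mul]
    have h1 := Finset.card_le_card hsub
    rw [Multiset.toFinset_card_of_nodup hnd, hZc] at h1
    have h2 := (IsAlgClosed.splits (d.map j)).natDegree_eq_card_roots
    rw [natDegree_map] at h2
    omega
  obtain ⟨⟨b1, hb1⟩, ha⟩ := IsLocalization.integerNormalization_map_to_map (nonZeroDivisors ℤ_[2])
    (EuclideanDomain.gcdA (P.map i) M)
  obtain ⟨⟨b2, hb2⟩, hb⟩ := IsLocalization.integerNormalization_map_to_map (nonZeroDivisors ℤ_[2])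
    (EuclideanDomain.gcdB (P.map i) M)
  set a1 := IsLocalization.integerNormalization (nonZeroDivisors ℤ_[2])
    (EuclideanDomain.gcdA (P.map i) M)
  set a2 := IsLocalization.integerNormalization (nonZeroDivisors ℤ_[2])
    (EuclideanDomain.gcdB (P.map i) M)
  have ha' : a1.map i = C (i b1) * EuclideanDomain.gcdA (P.map i) M := by
    rw [ha, ← algebraMap_smul ℚ_[2] b1, smul_eq_C_mul]
  have hb' : a2.map i = C (i b2) * EuclideanDomain.gcdB (P.map i) M := by
    rw [hb, ← algebraMap_smul ℚ_[2] b2, smul_eq_C_mul]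
  have hmap : (P * (C b2 * a1) + (X ^ n - 1) * (C b1 * a2)).map i = C (i b1 * i b2) * d := by
    rw [hd, hbez]
    simp only [Polynomial.map_add, Polynomial.map_mul, Polynomial.map_sub, Polynomial.map_pow,
      map_X, Polynomial.map_one, map_C, ha', hb', C_mul, hM]
    ring
  have hne : i b1 * i b2 ≠ 0 := by
    rw [← map_mul, hi]
    exact IsFractionRing.to_map_ne_zero_of_mem_nonZeroDivisors (mul_mem hb1 hb2)
  refine ⟨C b2 * a1, C b1 * a2, ?_, ?_⟩
  · rw [← Polynomial.map_ne_zero_iff hiinj, hmap]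
    exact mul_ne_zero (C_ne_zero.mpr hne) hd0
  · rw [← natDegree_map_eq_of_injective hiinj, hmap, natDegree_C_mul hne]
    exact hdeg

theorem stmt17 (n : ℕ) (hn : n.Prime) (hn8 : n % 8 = 7)
    (s : ℤ_[2]) (hs : s ^ 2 = -(n : ℤ_[2]))
    (α β γ : ℤ_[2])
    (hα : 2 * (n : ℤ_[2]) * α = n + 1)
    (hβ : 2 * (n : ℤ_[2]) * β = 1 + s)
    (hγ : 2 * (n : ℤ_[2]) * γ = 1 - s)
    (t : ℤ_[2]) (ht : (n : ℤ_[2]) * t ^ 2 = -1) :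
    (∃ t' : ℤ_[2], (n : ℤ_[2]) * t' ^ 2 = -1) ∧
    (∀ v ∈ qrCodeExt n α β γ t, v ≠ 0 → (n + 3) / 2 ≤ hwt v) ∧
    (∃ v ∈ qrCodeExt n α β γ t, v ≠ 0 ∧ hwt v = (n + 3) / 2) := by

  have ht0 : t ≠ 0 := by
    rintro rfl
    simp at ht
  have hinj : Function.Injective ((algebraMap ℚ_[2] (AlgebraicClosure ℚ_[2])).comp
      (algebraMap ℤ_[2] ℚ_[2])) :=
    (algebraMap ℚ_[2] (AlgebraicClosure ℚ_[2])).injective.comp (IsFractionRing.injective _ _)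
  have : CharZero (AlgebraicClosure ℚ_[2]) := algebraRat.charZero _
  obtain ⟨Z, hZc, hZ1, hZ⟩ := aux_Z ((algebraMap ℚ_[2] (AlgebraicClosure ℚ_[2])).comp
      (algebraMap ℤ_[2] ℚ_[2])) n hn hn8 s hs α β γ hα hβ hγ
  have hlow := aux_lower _ hinj n hn hn8 α β γ t ht0 Z hZc hZ1 hZ
  refine ⟨⟨t, ht⟩, hlow, ?_⟩
  obtain ⟨a, b, h0, hdeg⟩ := aux_word n hn (C α + C β * fQpoly n + C γ * fNpoly n) Z hZc
    (fun x hx h => (hZ x hx).mp h)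
  set p := (C α + C β * fQpoly n + C γ * fNpoly n) * a + (X ^ n - 1) * b with hp
  have hn1 := hn.two_le
  have hsum : ∑ j : Fin n, C (p.coeff j) * X ^ (j : ℕ) = p := by
    rw [Fin.sum_univ_eq_sum_range (fun j => C (p.coeff j) * X ^ j) n]
    exact (as_sum_range_C_mul_X_pow' p (by omega)).symm
  have hmem : (Fin.snoc (fun j : Fin n => p.coeff j) (t * ∑ j : Fin n, p.coeff j) :
      Fin (n + 1) → ℤ_[2]) ∈ qrCodeExt n α β γ t :=
    ⟨_, (aux_mem n α β γ _).mpr ⟨a, b, hsum⟩, rfl⟩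
  have hne : (Fin.snoc (fun j : Fin n => p.coeff j) (t * ∑ j : Fin n, p.coeff j) :
      Fin (n + 1) → ℤ_[2]) ≠ 0 := by
    intro h
    apply h0
    rw [← hsum]
    apply Finset.sum_eq_zero
    intro j _
    have := congrFun h j.castSucc
    rw [Fin.snoc_castSucc] at this
    simp only [Pi.zero_apply] at this
    rw [this]; simp
  refine ⟨_, hmem, hne, le_antisymm ?_ (hlow _ hmem hne)⟩
  rw [aux_snoc, ← aux_supp, hsum]
  have h1 : p.support.card ≤ p.natDegree + 1 := card_supp_le_succ_natDegree p
  split_ifs <;> omega
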